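/- Derivative of the quantum volume element along quantum powers of the Euler field: for every integer k ≥ 1, ∇_{E^k}Δ = Σ_{α,β} ⟨⟨E^k γ^α γ_α γ^β⟩⟩₀ γ_β = (k−b₁) E^{k−1}∘Δ − G(E^{k−1}∘Δ) − Σ_{i=1}^{k−1} Δ∘E^{i−1}∘G(E^{k−i}) − Σ_{i=1}^{k−1} G(Δ∘E^{i−1})∘E^{k−i}, where E^k denotes the k-th quantum power of E (with E⁰ := γ₁) and ∇_{E^k}Δ is the componentwise derivative of the vector field Δ in the direction E^k with respect to the trivial connection ∇ (∇γ_α = 0). -/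

import Mathlib

open scoped BigOperators

/-- Points of the small phase space `ℂ^N`. -/
abbrev Pt (N : ℕ) := Fin N → ℂ

/-- Vector fields on `ℂ^N` (components with respect to the basis `γ_α`). -/
abbrev VF (N : ℕ) := Pt N → Pt N

/-- Partial derivative `∂/∂t^α`. -/
noncomputable def pd {N : ℕ} (α : Fin N) (F : Pt N → ℂ) : Pt N → ℂ :=
  fun t => fderiv ℂ F t (Pi.single α 1)

/-- The `k`-point function `⟨⟨v₁ ⋯ v_k⟩⟩` associated with a generating function `F`. -/
noncomputable def corr {N : ℕ} : (Pt N → ℂ) → List (VF N) → Pt N → ℂ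
  | F, [] => F
  | F, v :: vs => fun t => ∑ α, v t α * corr (pd α F) vs t

/-- Constant vector field associated with an element of `ℂ^N`. -/
def cvf {N : ℕ} (x : Pt N) : VF N := fun _ => x

/-- The basis vector field `γ_α`. -/
noncomputable def bas {N : ℕ} (α : Fin N) : VF N := cvf (Pi.single α 1)

/-- The dual basis vector field `γ^α = η^{αβ} γ_β`. -/
noncomputable def dua {N : ℕ} (ηinv : Matrix (Fin N) (Fin N) ℂ) (α : Fin N) : VF N :=
  cvf (fun β => ηinv α β)

/-- The quantum product `v ∘ w := ⟨⟨v w γ^α⟩⟩₀ γ_α` of two vector fields. -/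
noncomputable def qp {N : ℕ} (F : Pt N → ℂ) (ηinv : Matrix (Fin N) (Fin N) ℂ)
    (v w : VF N) : VF N :=
  fun t σ => corr F [v, w, dua ηinv σ] t

/-- The grading operator `G(Σ f_α γ_α) = Σ b_α f_α γ_α`. -/
def Gop {N : ℕ} (b : Fin N → ℂ) (v : VF N) : VF N := fun t α => b α * v t α

/-- The Euler vector field `E = c + Σ_α (b₁ + 1 - b_α) t^α γ_α`. -/
def euler {N : ℕ} (c : Pt N) (b : Fin N → ℂ) (b1 : ℂ) : VF N :=
  fun t α => c α + (b1 + 1 - b α) * t α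

/-- The quantum volume element `Δ := γ^α ∘ γ_α`. -/
noncomputable def qvol {N : ℕ} (F : Pt N → ℂ) (ηinv : Matrix (Fin N) (Fin N) ℂ) : VF N :=
  fun t => ∑ α, qp F ηinv (dua ηinv α) (bas α) t

/-- Covariant derivative `∇_v w` with respect to the trivial connection (`∇ γ_α = 0`). -/
noncomputable def nablaVF {N : ℕ} (v w : VF N) : VF N :=
  fun t α => fderiv ℂ (fun s => w s α) t (v t)

/-- Derivative of a function along a vector field. -/
noncomputable def dirD {N : ℕ} (v : VF N) (f : Pt N → ℂ) : Pt N → ℂ :=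
  fun t => fderiv ℂ f t (v t)

/-- Quantum powers of a vector field: `E⁰ := γ₁`, `E^{k+1} := E ∘ E^k`. -/
noncomputable def epow {N : ℕ} [NeZero N] (F : Pt N → ℂ) (ηinv : Matrix (Fin N) (Fin N) ℂ)
    (E : VF N) : ℕ → VF N
  | 0 => bas 0
  | k + 1 => qp F ηinv E (epow F ηinv E k)

/-- The genus-0 part `G₀` of Getzler's equation. -/
noncomputable def G0func {N : ℕ} (F0 : Pt N → ℂ) (ηinv : Matrix (Fin N) (Fin N) ℂ)
    (v : Fin 4 → VF N) (t : Pt N) : ℂ :=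
  ∑ g : Equiv.Perm (Fin 4),
    ((1/6) * ∑ α, corr F0 [v (g 0), v (g 1), v (g 2), dua ηinv α] t *
        (∑ β, corr F0 [bas α, v (g 3), bas β, dua ηinv β] t)
    + (1/24) * ∑ α, corr F0 [v (g 0), v (g 1), v (g 2), v (g 3), dua ηinv α] t *
        (∑ β, corr F0 [bas α, bas β, dua ηinv β] t)
    - (1/4) * ∑ α, ∑ β, corr F0 [v (g 0), v (g 1), dua ηinv α, dua ηinv β] t *
        corr F0 [bas α, bas β, v (g 2), v (g 3)] t)

/-- The genus-1 part `G₁` of Getzler's equation. -/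
noncomputable def G1func {N : ℕ} (F0 F1 : Pt N → ℂ) (ηinv : Matrix (Fin N) (Fin N) ℂ)
    (v : Fin 4 → VF N) (t : Pt N) : ℂ :=
  ∑ g : Equiv.Perm (Fin 4),
    (3 * corr F1 [qp F0 ηinv (v (g 0)) (v (g 1)), qp F0 ηinv (v (g 2)) (v (g 3))] t
    - 4 * corr F1 [qp F0 ηinv (qp F0 ηinv (v (g 0)) (v (g 1))) (v (g 2)), v (g 3)] t
    - ∑ α, corr F0 [qp F0 ηinv (v (g 0)) (v (g 1)), v (g 2), v (g 3), dua ηinv α] t *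
        corr F1 [bas α] t
    + 2 * ∑ α, corr F0 [v (g 0), v (g 1), v (g 2), dua ηinv α] t *
        corr F1 [qp F0 ηinv (bas α) (v (g 3))] t)

section PartialDerivatives

variable {N : ℕ} {F : Pt N → ℂ}

theorem fderiv_eq_sum_pd (f : Pt N → ℂ) (t d : Pt N) :
    fderiv ℂ f t d = ∑ δ, d δ * pd δ f t := by
  conv_lhs => rw [pi_eq_sum_univ' d]
  simp [pd]

theorem analyticAt_pd (hF : ∀ t, AnalyticAt ℂ F t) (α : Fin N) (t : Pt N) :
    AnalyticAt ℂ (pd α F) t :=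
  ((ContinuousLinearMap.apply ℂ ℂ (Pi.single α 1 : Pt N)).analyticAt _).comp (hF t).fderiv

theorem pd_comm (hF : ∀ t, AnalyticAt ℂ F t) (α β : Fin N) :
    pd α (pd β F) = pd β (pd α F) := by
  funext t
  have hd : DifferentiableAt ℂ (fderiv ℂ F) t := (hF t).fderiv.differentiableAt
  have hsymm := ((hF t).contDiffAt (n := 2)).isSymmSndFDerivAt (by simp)
  have key : ∀ γ δ : Fin N,
      pd γ (pd δ F) t = fderiv ℂ (fderiv ℂ F) t (Pi.single γ 1) (Pi.single δ 1) := by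
    intro γ δ
    change fderiv ℂ (fun s => fderiv ℂ F s (Pi.single δ 1)) t (Pi.single γ 1) = _
    rw [fderiv_clm_apply hd (differentiableAt_const _)]
    simp
  rw [key, key, hsymm.eq]

/-- Differentiating a quasi-homogeneity equation shifts its degree. -/
theorem fderiv_pd_euler {c : Pt N} {b : Fin N → ℂ} {b1 κ : ℂ} {q : Pt N → ℂ}
    (hF : ∀ t, AnalyticAt ℂ F t) (hq : Differentiable ℂ q)
    (hE : ∀ t, fderiv ℂ F t (euler c b b1 t) = κ * F t + q t) (α : Fin N) (t : Pt N) :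
    fderiv ℂ (pd α F) t (euler c b b1 t)
      = (κ - (b1 + 1 - b α)) * pd α F t + pd α q t := by
  have hproj : ∀ δ : Fin N, DifferentiableAt ℂ (fun s : Pt N => s δ) t := by
    intro δ; fun_prop
  have hprojd : ∀ δ : Fin N,
      fderiv ℂ (fun s : Pt N => s δ) t (Pi.single α 1) = (Pi.single α 1 : Pt N) δ := by
    intro δ
    exact congrArg (fun L : Pt N →L[ℂ] ℂ => L (Pi.single α 1))
      (ContinuousLinearMap.proj (R := ℂ) (φ := fun _ : Fin N => ℂ) δ).fderiv
  have hpd : ∀ δ, DifferentiableAt ℂ (pd δ F) t := fun δ =>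
    (analyticAt_pd hF δ t).differentiableAt
  have hcoef : ∀ δ, DifferentiableAt ℂ (fun s => euler c b b1 s δ) t := by
    intro δ; unfold euler; fun_prop
  have hcoefd : ∀ δ, fderiv ℂ (fun s => euler c b b1 s δ) t (Pi.single α 1)
      = (b1 + 1 - b δ) * (Pi.single α 1 : Pt N) δ := by
    intro δ
    unfold euler
    rw [fderiv_const_add, fderiv_const_mul (hproj δ)]
    simp [hprojd]
  have hfun : (fun s => ∑ δ, euler c b b1 s δ * pd δ F s) = fun s => κ * F s + q s := by
    funext s
    rw [← fderiv_eq_sum_pd, hE]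
  have hder := congrArg (fun f => fderiv ℂ f t (Pi.single α 1)) hfun
  rw [fderiv_fun_sum fun δ _ => (hcoef δ).fun_mul (hpd δ),
    fderiv_fun_add ((hF t).differentiableAt.const_mul κ) (hq t),
    fderiv_const_mul (hF t).differentiableAt] at hder
  simp only [sum_apply, add_apply, smul_apply, smul_eq_mul, fderiv_fun_mul (hcoef _) (hpd _), hcoefd,
    Finset.sum_add_distrib] at hder
  have hswap : ∀ δ, fderiv ℂ (pd δ F) t (Pi.single α 1) = pd δ (pd α F) t := fun δ =>
    congrFun (pd_comm hF α δ) t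
  simp only [hswap, ← fderiv_eq_sum_pd] at hder
  have hsum : ∑ δ, pd δ F t * ((b1 + 1 - b δ) * (Pi.single α 1 : Pt N) δ)
      = (b1 + 1 - b α) * pd α F t := by
    simp [Pi.single_apply, mul_comm]
  rw [hsum] at hder
  change _ = κ * pd α F t + pd α q t at hder
  linear_combination hder

theorem pd_quadratic {C : Matrix (Fin N) (Fin N) ℂ} (hC : C.IsSymm) (γ : Fin N) :
    pd γ (fun t => (1/2) * ∑ α, ∑ β, C α β * t α * t β) = fun t => ∑ β, C γ β * t β := by
  funext t
  have hp : ∀ δ : Fin N, HasFDerivAt (fun s : Pt N => s δ)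
      (ContinuousLinearMap.proj (R := ℂ) (φ := fun _ : Fin N => ℂ) δ) t := fun δ =>
    hasFDerivAt_apply δ t
  have h : HasFDerivAt (fun t : Pt N => (1/2 : ℂ) * ∑ α, ∑ β, C α β * t α * t β) _ t :=
    (HasFDerivAt.fun_sum fun α _ => HasFDerivAt.fun_sum fun β _ =>
      ((hp α).const_mul (C α β)).mul (hp β)).const_mul (1/2)
  have hs : ∀ α, C α γ = C γ α := fun α => hC.apply γ α
  unfold pd
  rw [h.fderiv]
  simp [Pi.single_apply, Finset.sum_add_distrib, mul_ite, hs]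
  simp only [mul_comm]
  ring

theorem pd_linear (l : Pt N) (γ : Fin N) : pd γ (fun t => ∑ β, l β * t β) = fun _ => l γ := by
  funext t
  have hp : ∀ δ : Fin N, HasFDerivAt (fun s : Pt N => s δ)
      (ContinuousLinearMap.proj (R := ℂ) (φ := fun _ : Fin N => ℂ) δ) t := fun δ =>
    hasFDerivAt_apply δ t
  have h : HasFDerivAt (fun t : Pt N => ∑ β, l β * t β) _ t :=
    HasFDerivAt.fun_sum fun β _ => (hp β).const_mul (l β)
  unfold pd
  rw [h.fderiv]
  simp [Pi.single_apply]

theorem pd_const (a : ℂ) (γ : Fin N) : pd γ (fun _ : Pt N => a) = fun _ => 0 := by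
  funext t
  simp [pd]

end PartialDerivatives

/-- The third partial derivatives of a quasi-homogeneous potential are homogeneous. -/
theorem fderiv_pd_three_euler {N : ℕ} {F : Pt N → ℂ} {c : Pt N} {b : Fin N → ℂ} {b1 : ℂ}
    {C : Matrix (Fin N) (Fin N) ℂ} (hC : C.IsSymm) (hF : ∀ t, AnalyticAt ℂ F t)
    (hE : ∀ t, fderiv ℂ F t (euler c b b1 t)
      = 2 * (b1 + 1) * F t + (1/2) * ∑ α, ∑ β, C α β * t α * t β)
    (α β μ : Fin N) (t : Pt N) :
    fderiv ℂ (pd μ (pd β (pd α F))) t (euler c b b1 t)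
      = (b α + b β + b μ - b1 - 1) * pd μ (pd β (pd α F)) t := by
  have h1 := fderiv_pd_euler hF (by fun_prop) hE α
  rw [pd_quadratic hC] at h1
  have h2 := fderiv_pd_euler (analyticAt_pd hF α) (by fun_prop) h1 β
  rw [pd_linear] at h2
  have h3 := fderiv_pd_euler (analyticAt_pd (analyticAt_pd hF α) β) (by fun_prop) h2 μ t
  rw [pd_const] at h3
  rw [h3]
  ring

section QuantumProduct

variable {N : ℕ}

/-- The quantum product at a point, as a bilinear map. -/
noncomputable def qmul (F : Pt N → ℂ) (ηinv : Matrix (Fin N) (Fin N) ℂ) (t : Pt N) :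
    Pt N →ₗ[ℂ] Pt N →ₗ[ℂ] Pt N :=
  LinearMap.mk₂ ℂ (fun x y => qp F ηinv (cvf x) (cvf y) t)
    (by intro x x' y; funext σ; simp [qp, corr, cvf, add_mul, Finset.sum_add_distrib])
    (by intro a x y; funext σ; simp [qp, corr, cvf, Finset.mul_sum, mul_assoc])
    (by
      intro x y y'; funext σ
      simp [qp, corr, cvf, add_mul, mul_add, Finset.sum_add_distrib])
    (by
      intro a x y; funext σ
      simp only [qp, corr, cvf, Pi.smul_apply, smul_eq_mul, Finset.mul_sum]
      refine Finset.sum_congr rfl fun _ _ => Finset.sum_congr rfl fun _ _ =>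
        Finset.sum_congr rfl fun _ _ => by ring)

/-- The four-point function with its last index raised. -/
noncomputable def quart (F : Pt N → ℂ) (ηinv : Matrix (Fin N) (Fin N) ℂ) (t d x y : Pt N) :
    Pt N :=
  fun σ => corr F [cvf d, cvf x, cvf y, dua ηinv σ] t

/-- The grading operator at a point, as a linear map. -/
def gradingMap (b : Fin N → ℂ) : Pt N →ₗ[ℂ] Pt N where
  toFun x := fun α => b α * x α
  map_add' x y := by funext α; simp [mul_add]
  map_smul' a x := by funext α; simp [mul_left_comm]

variable {F : Pt N → ℂ} {ηinv : Matrix (Fin N) (Fin N) ℂ}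

theorem qp_eq_qmul (v w : VF N) (t : Pt N) : qp F ηinv v w t = qmul F ηinv t (v t) (w t) :=
  (rfl)

theorem Gop_eq_gradingMap (b : Fin N → ℂ) (v : VF N) (t : Pt N) :
    Gop b v t = gradingMap b (v t) :=
  (rfl)

theorem qmul_apply (t x y : Pt N) (σ : Fin N) :
    qmul F ηinv t x y σ
      = ∑ α, ∑ β, ∑ μ, x α * y β * ηinv σ μ * pd μ (pd β (pd α F)) t := by
  change corr F _ t = _
  simp only [corr, cvf, dua, Finset.mul_sum]
  refine Finset.sum_congr rfl fun _ _ => Finset.sum_congr rfl fun _ _ =>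
    Finset.sum_congr rfl fun _ _ => by ring

theorem qmul_comm (hF : ∀ t, AnalyticAt ℂ F t) (t x y : Pt N) :
    qmul F ηinv t x y = qmul F ηinv t y x := by
  funext σ
  rw [qmul_apply, qmul_apply, Finset.sum_comm]
  refine Finset.sum_congr rfl fun β _ => Finset.sum_congr rfl fun α _ =>
    Finset.sum_congr rfl fun μ _ => ?_
  rw [pd_comm hF β α]
  ring

theorem quart_swap (hF : ∀ t, AnalyticAt ℂ F t) (t d x y : Pt N) :
    quart F ηinv t d x y = quart F ηinv t x d y := by
  funext σ
  simp only [quart, corr, cvf, Finset.mul_sum]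
  rw [Finset.sum_comm]
  refine Finset.sum_congr rfl fun β _ => Finset.sum_congr rfl fun α _ =>
    Finset.sum_congr rfl fun μ _ => Finset.sum_congr rfl fun ν _ => ?_
  rw [pd_comm hF β α]
  ring

theorem quart_apply (hF : ∀ t, AnalyticAt ℂ F t) (t d x y : Pt N) (σ : Fin N) :
    quart F ηinv t d x y σ
      = ∑ α, ∑ β, ∑ μ, x α * y β * ηinv σ μ * fderiv ℂ (pd μ (pd β (pd α F))) t d := by
  simp only [quart, corr, cvf, dua, Finset.mul_sum, fderiv_eq_sum_pd _ t d]
  rw [Finset.sum_comm]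
  refine Finset.sum_congr rfl fun α _ => ?_
  rw [Finset.sum_comm]
  refine Finset.sum_congr rfl fun β _ => ?_
  rw [Finset.sum_comm]
  refine Finset.sum_congr rfl fun μ _ => Finset.sum_congr rfl fun δ _ => ?_
  rw [pd_comm (analyticAt_pd (analyticAt_pd hF α) β) δ μ, pd_comm (analyticAt_pd hF α) δ β,
    pd_comm hF δ α]
  ring

theorem differentiable_qp (hF : ∀ t, AnalyticAt ℂ F t) {x y : VF N}
    (hx : Differentiable ℂ x) (hy : Differentiable ℂ y) : Differentiable ℂ (qp F ηinv x y) := by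
  have hpd : ∀ α β μ, Differentiable ℂ (pd μ (pd β (pd α F))) := fun α β μ t =>
    (analyticAt_pd (analyticAt_pd (analyticAt_pd hF α) β) μ t).differentiableAt
  rw [differentiable_pi] at hx hy ⊢
  intro σ
  simp only [qp_eq_qmul, qmul_apply]
  fun_prop

/-- Leibniz rule for the quantum product. -/
theorem fderiv_qp (hF : ∀ t, AnalyticAt ℂ F t) {x y : VF N}
    (hx : Differentiable ℂ x) (hy : Differentiable ℂ y) (t d : Pt N) :
    fderiv ℂ (qp F ηinv x y) t d = quart F ηinv t d (x t) (y t)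
      + qmul F ηinv t (fderiv ℂ x t d) (y t) + qmul F ηinv t (x t) (fderiv ℂ y t d) := by
  have hpd : ∀ α β μ, HasFDerivAt (pd μ (pd β (pd α F))) (fderiv ℂ (pd μ (pd β (pd α F))) t) t :=
    fun α β μ =>
      (analyticAt_pd (analyticAt_pd (analyticAt_pd hF α) β) μ t).differentiableAt.hasFDerivAt
  have hx' := hasFDerivAt_pi'.1 (hx t).hasFDerivAt
  have hy' := hasFDerivAt_pi'.1 (hy t).hasFDerivAt
  funext σ
  have hσ := hasFDerivAt_pi'.1 (differentiable_qp (ηinv := ηinv) hF hx hy t).hasFDerivAt σ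
  simp only [qp_eq_qmul, qmul_apply] at hσ
  have h := hσ.unique (HasFDerivAt.fun_sum fun α _ => HasFDerivAt.fun_sum fun β _ =>
    HasFDerivAt.fun_sum fun μ _ => (((hx' α).mul (hy' β)).mul_const (ηinv σ μ)).mul (hpd α β μ))
  have hd := congrArg (fun L : Pt N →L[ℂ] ℂ => L d) h
  simp only [ContinuousLinearMap.comp_apply, ContinuousLinearMap.proj_apply] at hd
  rw [hd, Pi.add_apply, Pi.add_apply, quart_apply hF, qmul_apply, qmul_apply]
  simp only [← Finset.sum_add_distrib, sum_apply]
  refine Finset.sum_congr rfl fun _ _ => Finset.sum_congr rfl fun _ _ =>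
    Finset.sum_congr rfl fun _ _ => ?_
  simp
  ring

theorem qmul_assoc
    (hwdvv : ∀ u v w : VF N, qp F ηinv (qp F ηinv u v) w = qp F ηinv u (qp F ηinv v w))
    (t x y z : Pt N) :
    qmul F ηinv t (qmul F ηinv t x y) z = qmul F ηinv t x (qmul F ηinv t y z) :=
  congrFun (hwdvv (cvf x) (cvf y) (cvf z)) t

/-- The derivative of the associativity equation. -/
theorem quart_qmul (hF : ∀ t, AnalyticAt ℂ F t)
    (hwdvv : ∀ u v w : VF N, qp F ηinv (qp F ηinv u v) w = qp F ηinv u (qp F ηinv v w))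
    (t d x y z : Pt N) :
    quart F ηinv t d (qmul F ηinv t x y) z + qmul F ηinv t (quart F ηinv t d x y) z
      = quart F ηinv t d x (qmul F ηinv t y z) + qmul F ηinv t x (quart F ηinv t d y z) := by
  have hc : ∀ u : Pt N, Differentiable ℂ (cvf u : VF N) := fun u => differentiable_const u
  have hc' : ∀ u : Pt N, fderiv ℂ (cvf u : VF N) t d = 0 := fun u => by
    rw [show (cvf u : VF N) = fun _ => u from rfl, fderiv_const_apply, zero_apply]
  have h := congrArg (fun f => fderiv ℂ f t d) (hwdvv (cvf x) (cvf y) (cvf z))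
  simp only [fderiv_qp hF (differentiable_qp hF (hc x) (hc y)) (hc z),
    fderiv_qp hF (hc x) (differentiable_qp hF (hc y) (hc z)), fderiv_qp hF (hc x) (hc y),
    fderiv_qp hF (hc y) (hc z), hc', map_zero, LinearMap.zero_apply, add_zero] at h
  exact h

/-- The four-point function with an Euler field inserted. -/
theorem quart_euler {c : Pt N} {b : Fin N → ℂ} {b1 : ℂ} {C : Matrix (Fin N) (Fin N) ℂ}
    (hb : ∀ α β, ηinv α β ≠ 0 → b α + b β = 1) (hC : C.IsSymm) (hF : ∀ t, AnalyticAt ℂ F t)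
    (hE : ∀ t, fderiv ℂ F t (euler c b b1 t)
      = 2 * (b1 + 1) * F t + (1/2) * ∑ α, ∑ β, C α β * t α * t β) (t x y : Pt N) :
    quart F ηinv t (euler c b b1 t) x y
      = qmul F ηinv t (gradingMap b x) y + qmul F ηinv t x (gradingMap b y)
        - gradingMap b (qmul F ηinv t x y) - b1 • qmul F ηinv t x y := by
  funext σ
  change _ = qmul F ηinv t (gradingMap b x) y σ + qmul F ηinv t x (gradingMap b y) σ
        - b σ * qmul F ηinv t x y σ - b1 * qmul F ηinv t x y σ
  simp only [quart_apply hF, qmul_apply, Finset.mul_sum, ← Finset.sum_add_distrib,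
    ← Finset.sum_sub_distrib]
  refine Finset.sum_congr rfl fun α _ => Finset.sum_congr rfl fun β _ =>
    Finset.sum_congr rfl fun μ _ => ?_
  rw [fderiv_pd_three_euler hC hF hE]
  change _ = b α * x α * y β * ηinv σ μ * _ + x α * (b β * y β) * ηinv σ μ * _ - _ - _
  by_cases h : ηinv σ μ = 0
  · simp [h]
  · rw [show b μ = 1 - b σ by linear_combination hb σ μ h]
    ring

end QuantumProduct

section Casimir

variable {N : ℕ}

/-- Contraction `∑ α, B (γ^α) (γ_α)` of a bilinear map with the inverse metric. -/
noncomputable def casimir (ηinv : Matrix (Fin N) (Fin N) ℂ)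
    (B : Pt N →ₗ[ℂ] Pt N →ₗ[ℂ] Pt N) : Pt N :=
  ∑ α, B (ηinv α) (Pi.single α 1)

variable {ηinv : Matrix (Fin N) (Fin N) ℂ} (B : Pt N →ₗ[ℂ] Pt N →ₗ[ℂ] Pt N)

theorem casimir_eq_sum :
    casimir ηinv B = ∑ α, ∑ β, ηinv α β • B (Pi.single β 1) (Pi.single α 1) := by
  unfold casimir
  refine Finset.sum_congr rfl fun α _ => ?_
  conv_lhs => rw [pi_eq_sum_univ' (ηinv α)]
  simp

theorem casimir_flip (hη : ηinv.IsSymm) : casimir ηinv B.flip = casimir ηinv B := by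
  rw [casimir_eq_sum, casimir_eq_sum, Finset.sum_comm]
  refine Finset.sum_congr rfl fun α _ => Finset.sum_congr rfl fun β _ => ?_
  rw [hη.apply, LinearMap.flip_apply]

theorem casimir_adjoint {A A' : Pt N →ₗ[ℂ] Pt N}
    (hA : ∀ α β, A (ηinv α) β = ∑ μ, ηinv μ β * A' (Pi.single μ 1) α) :
    casimir ηinv (B.compl₁₂ A .id) = casimir ηinv (B.compl₁₂ .id A') := by
  have hleft : casimir ηinv (B.compl₁₂ A .id)
      = ∑ α, ∑ β, ∑ μ, (ηinv μ β * A' (Pi.single μ 1) α) •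
          B (Pi.single β 1) (Pi.single α 1) := by
    unfold casimir
    refine Finset.sum_congr rfl fun α _ => ?_
    simp only [← Finset.sum_smul, ← hA]
    conv_lhs => rw [LinearMap.compl₁₂_apply, pi_eq_sum_univ' (A (ηinv α))]
    simp
  have hright : casimir ηinv (B.compl₁₂ .id A')
      = ∑ μ, ∑ β, ∑ α, (ηinv μ β * A' (Pi.single μ 1) α) •
          B (Pi.single β 1) (Pi.single α 1) := by
    rw [casimir_eq_sum]
    refine Finset.sum_congr rfl fun μ _ => Finset.sum_congr rfl fun β _ => ?_
    conv_lhs => rw [LinearMap.compl₁₂_apply, pi_eq_sum_univ' (A' (Pi.single μ 1))]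
    simp [Finset.smul_sum, mul_smul]
  rw [hleft, hright, Finset.sum_comm, Finset.sum_comm (s := Finset.univ (α := Fin N))
    (f := fun μ β => ∑ α, (ηinv μ β * A' (Pi.single μ 1) α) •
          B (Pi.single β 1) (Pi.single α 1))]
  exact Finset.sum_congr rfl fun β _ => Finset.sum_comm

theorem casimir_grading {b : Fin N → ℂ} (hb : ∀ α β, ηinv α β ≠ 0 → b α + b β = 1) :
    casimir ηinv (B.compl₁₂ (gradingMap b) .id)
      = casimir ηinv B - casimir ηinv (B.compl₁₂ .id (gradingMap b)) := by
  have h := casimir_adjoint (ηinv := ηinv) (A := gradingMap b) (A' := .id - gradingMap b) B (by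
    intro α β
    change b β * ηinv α β = ∑ μ, ηinv μ β * ((Pi.single μ 1 : Pt N) α
      - b α * (Pi.single μ 1 : Pt N) α)
    simp only [Pi.single_apply, mul_sub, mul_ite, mul_one, mul_zero, Finset.sum_sub_distrib,
      Finset.sum_ite_eq, Finset.mem_univ, if_true]
    by_cases h0 : ηinv α β = 0
    · simp [h0]
    · linear_combination ηinv α β * hb α β h0)
  rw [h]
  simp [casimir, Finset.sum_sub_distrib]

theorem casimir_qmul {F : Pt N → ℂ} (hF : ∀ t, AnalyticAt ℂ F t) (hη : ηinv.IsSymm)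
    (t v : Pt N) :
    casimir ηinv (B.compl₁₂ (qmul F ηinv t v) .id)
      = casimir ηinv (B.compl₁₂ .id (qmul F ηinv t v)) := by
  refine casimir_adjoint B fun α β => ?_
  have hsingle : ∀ μ, qmul F ηinv t v (Pi.single μ 1) α
      = ∑ a, ∑ ν, v a * ηinv α ν * pd ν (pd μ (pd a F)) t := by
    intro μ
    rw [qmul_apply]
    refine Finset.sum_congr rfl fun a _ => ?_
    rw [Finset.sum_eq_single μ (by intro β _ h; simp [h]) (by simp)]
    simp
  simp only [hsingle, qmul_apply, Finset.mul_sum]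
  conv_rhs => rw [Finset.sum_comm]
  refine Finset.sum_congr rfl fun a _ => ?_
  conv_rhs => rw [Finset.sum_comm]
  refine Finset.sum_congr rfl fun ν _ => Finset.sum_congr rfl fun μ _ => ?_
  rw [pd_comm (analyticAt_pd hF a) μ ν, hη.apply β μ]
  ring

end Casimir

section Recursion

variable {N : ℕ} {F : Pt N → ℂ} {ηinv : Matrix (Fin N) (Fin N) ℂ}

theorem qvol_eq_casimir (t : Pt N) : qvol F ηinv t = casimir ηinv (qmul F ηinv t) := rfl

theorem casimir_qmul_compl_comm (hF : ∀ t, AnalyticAt ℂ F t) (hη : ηinv.IsSymm) (t : Pt N)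
    (A : Pt N →ₗ[ℂ] Pt N) :
    casimir ηinv ((qmul F ηinv t).compl₁₂ .id A)
      = casimir ηinv ((qmul F ηinv t).compl₁₂ A .id) := by
  rw [← casimir_flip _ hη]
  congr 1
  refine LinearMap.ext fun x => LinearMap.ext fun y => ?_
  exact qmul_comm hF t _ _

theorem casimir_qmul_grading (hF : ∀ t, AnalyticAt ℂ F t) (hη : ηinv.IsSymm) {b : Fin N → ℂ}
    (hb : ∀ α β, ηinv α β ≠ 0 → b α + b β = 1) (t : Pt N) :
    (2 : ℂ) • casimir ηinv ((qmul F ηinv t).compl₁₂ (gradingMap b) .id) = qvol F ηinv t := by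
  have h := casimir_grading (qmul F ηinv t) hb
  rw [casimir_qmul_compl_comm hF hη] at h
  rw [qvol_eq_casimir, two_smul]
  nth_rewrite 1 [h]
  abel

/-- The contraction of `G ∘ (v ∘ ·)` against the quantum product is half of `v ∘ Δ`. -/
theorem casimir_qmul_grading_qmul (hF : ∀ t, AnalyticAt ℂ F t) (hη : ηinv.IsSymm)
    {b : Fin N → ℂ} (hb : ∀ α β, ηinv α β ≠ 0 → b α + b β = 1)
    (hwdvv : ∀ u v w : VF N, qp F ηinv (qp F ηinv u v) w = qp F ηinv u (qp F ηinv v w))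
    (t v : Pt N) :
    (2 : ℂ) • casimir ηinv ((qmul F ηinv t).compl₁₂ .id (gradingMap b ∘ₗ qmul F ηinv t v))
      = qmul F ηinv t v (qvol F ηinv t) := by
  set m := qmul F ηinv t with hm
  have hadj : casimir ηinv (m.compl₁₂ .id (gradingMap b ∘ₗ m v))
      = casimir ηinv ((m.compl₁₂ (m v) .id).compl₁₂ .id (gradingMap b)) :=
    (casimir_qmul (m.compl₁₂ .id (gradingMap b)) hF hη t v).symm
  have hvol : casimir ηinv (m.compl₁₂ (m v) .id) = m v (qvol F ηinv t) := by
    simp [qvol_eq_casimir, casimir, hm, qmul_assoc hwdvv]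
  have hgr : casimir ηinv ((m.compl₁₂ (m v) .id).compl₁₂ (gradingMap b) .id)
      = m v (casimir ηinv (m.compl₁₂ (gradingMap b) .id)) := by
    simp [casimir, hm, qmul_assoc hwdvv]
  have h := casimir_grading (m.compl₁₂ (m v) .id) hb
  have h2 : (2 : ℂ) • m v (casimir ηinv (m.compl₁₂ (gradingMap b) .id))
      = m v (qvol F ηinv t) := by
    rw [← map_smul, casimir_qmul_grading hF hη hb t]
  rw [← hadj, hvol, hgr] at h
  rw [eq_sub_iff_add_eq, ← eq_sub_iff_add_eq'] at h
  rw [h, smul_sub, h2, two_smul]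
  abel

theorem nablaVF_qvol (hF : ∀ t, AnalyticAt ℂ F t) (v : VF N) (t : Pt N) :
    nablaVF v (qvol F ηinv) t = ∑ α, quart F ηinv t (v t) (ηinv α) (Pi.single α 1) := by
  have hc : ∀ u : Pt N, Differentiable ℂ (cvf u : VF N) := fun u => differentiable_const u
  have hc' : ∀ u : Pt N, fderiv ℂ (cvf u : VF N) t (v t) = 0 := fun u => by
    rw [show (cvf u : VF N) = fun _ => u from rfl, fderiv_const_apply, zero_apply]
  have hq : ∀ α, Differentiable ℂ (qp F ηinv (dua ηinv α) (bas α)) := fun α =>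
    differentiable_qp hF (hc _) (hc _)
  have hvol : HasFDerivAt (qvol F ηinv) _ t :=
    HasFDerivAt.fun_sum (u := Finset.univ) fun α _ => (hq α t).hasFDerivAt
  funext σ
  change fderiv ℂ (fun s => qvol F ηinv s σ) t (v t) = _
  rw [(hasFDerivAt_pi'.1 hvol σ).fderiv, ContinuousLinearMap.comp_apply,
    ContinuousLinearMap.proj_apply, sum_apply]
  refine congrFun (Finset.sum_congr rfl fun α _ => ?_) σ
  unfold dua bas
  rw [fderiv_qp hF (hc _) (hc _), hc', hc', map_zero, map_zero, LinearMap.zero_apply,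
    add_zero, add_zero]
  rfl

theorem sum_corr_smul_single (v : VF N) (t : Pt N) :
    (∑ β, (∑ α, corr F [v, dua ηinv α, bas α, dua ηinv β] t) • (Pi.single β 1 : Pt N))
      = ∑ α, quart F ηinv t (v t) (ηinv α) (Pi.single α 1) := by
  rw [← pi_eq_sum_univ' (fun β => ∑ α, corr F [v, dua ηinv α, bas α, dua ηinv β] t)]
  funext β
  rw [Finset.sum_apply]
  rfl

theorem epow_succ [NeZero N] (E : VF N) (k : ℕ) (t : Pt N) :
    epow F ηinv E (k + 1) t = qmul F ηinv t (E t) (epow F ηinv E k t) := by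
  rw [epow, qp_eq_qmul]

theorem qmul_epow_zero [NeZero N] (hid : ∀ v : VF N, qp F ηinv (bas 0) v = v) (E : VF N)
    (t x : Pt N) : qmul F ηinv t (epow F ηinv E 0 t) x = x := by
  have h := congrFun (hid (cvf x)) t
  rwa [qp_eq_qmul] at h

/-- The trace of the four-point function along the Euler field. -/
theorem sum_quart_euler {c : Pt N} {b : Fin N → ℂ} {b1 : ℂ} {C : Matrix (Fin N) (Fin N) ℂ}
    (hη : ηinv.IsSymm) (hb : ∀ α β, ηinv α β ≠ 0 → b α + b β = 1) (hC : C.IsSymm)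
    (hF : ∀ t, AnalyticAt ℂ F t)
    (hE : ∀ t, fderiv ℂ F t (euler c b b1 t)
      = 2 * (b1 + 1) * F t + (1/2) * ∑ α, ∑ β, C α β * t α * t β) (t : Pt N) :
    ∑ α, quart F ηinv t (euler c b b1 t) (ηinv α) (Pi.single α 1)
      = (1 - b1) • qvol F ηinv t - gradingMap b (qvol F ηinv t) := by
  have hsum : ∑ α, quart F ηinv t (euler c b b1 t) (ηinv α) (Pi.single α 1)
      = casimir ηinv ((qmul F ηinv t).compl₁₂ (gradingMap b) .id)
        + casimir ηinv ((qmul F ηinv t).compl₁₂ .id (gradingMap b))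
        - gradingMap b (casimir ηinv (qmul F ηinv t))
        - b1 • casimir ηinv (qmul F ηinv t) := by
    simp [quart_euler hb hC hF hE, casimir, Finset.sum_add_distrib, Finset.sum_sub_distrib,
      Finset.smul_sum]
  rw [hsum, casimir_qmul_compl_comm hF hη, ← two_smul ℂ, casimir_qmul_grading hF hη hb,
    ← qvol_eq_casimir]
  module

/-- The trace of the four-point function along `E ∘ v`. -/
theorem sum_quart_euler_qmul {c : Pt N} {b : Fin N → ℂ} {b1 : ℂ}
    {C : Matrix (Fin N) (Fin N) ℂ}
    (hη : ηinv.IsSymm) (hb : ∀ α β, ηinv α β ≠ 0 → b α + b β = 1) (hC : C.IsSymm)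
    (hF : ∀ t, AnalyticAt ℂ F t)
    (hwdvv : ∀ u v w : VF N, qp F ηinv (qp F ηinv u v) w = qp F ηinv u (qp F ηinv v w))
    (hE : ∀ t, fderiv ℂ F t (euler c b b1 t)
      = 2 * (b1 + 1) * F t + (1/2) * ∑ α, ∑ β, C α β * t α * t β) (t v : Pt N) :
    ∑ α, quart F ηinv t (qmul F ηinv t (euler c b b1 t) v) (ηinv α) (Pi.single α 1)
      = qmul F ηinv t (euler c b b1 t) (∑ α, quart F ηinv t v (ηinv α) (Pi.single α 1))
        + qmul F ηinv t (qvol F ηinv t) v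
        - gradingMap b (qmul F ηinv t (qvol F ηinv t) v)
        - qmul F ηinv t (qvol F ηinv t) (gradingMap b v) := by
  set m := qmul F ηinv t with hm
  set e := euler c b b1 t with he
  have hcomm : ∀ x y, m x y = m y x := qmul_comm hF t
  have hassoc : ∀ x y z, m (m x y) z = m x (m y z) := qmul_assoc hwdvv t
  have hterm : ∀ x y : Pt N, quart F ηinv t (m e v) x y
      = m e (quart F ηinv t v x y) + (m x (gradingMap b (m v y)) + m (gradingMap b (m v x)) y)
        - gradingMap b (m (m x y) v) - m (m x y) (gradingMap b v) := by
    intro x y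
    have h := quart_qmul hF hwdvv t x e v y
    rw [quart_swap hF t x, quart_swap hF t x, quart_swap hF t x e, quart_swap hF t x v,
      he, quart_euler hb hC hF hE, quart_euler hb hC hF hE, ← he, ← hm] at h
    simp only [map_add, map_sub, map_smul, LinearMap.add_apply, LinearMap.sub_apply,
      LinearMap.smul_apply, hassoc] at h
    rw [hassoc x y v, hassoc x y (gradingMap b v), hcomm y v, hcomm y (gradingMap b v),
      hcomm v x, eq_sub_of_add_eq h]
    abel
  have hcas : ∑ α, m (ηinv α) (gradingMap b (m v (Pi.single α 1)))
        + ∑ α, m (gradingMap b (m v (ηinv α))) (Pi.single α 1) = m (qvol F ηinv t) v := by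
    change casimir ηinv (m.compl₁₂ .id (gradingMap b ∘ₗ m v))
        + casimir ηinv (m.compl₁₂ (gradingMap b ∘ₗ m v) .id) = _
    rw [← casimir_qmul_compl_comm hF hη, ← two_smul ℂ,
      casimir_qmul_grading_qmul hF hη hb hwdvv, ← hm, hcomm]
  have hvol : ∀ w, ∑ α, m (m (ηinv α) (Pi.single α 1)) w = m (qvol F ηinv t) w := by
    intro w
    simp [qvol_eq_casimir, casimir, hm]
  simp only [hterm, Finset.sum_add_distrib, Finset.sum_sub_distrib, hcas, hvol, ← map_sum]

end Recursion

/-- Solution of the recursion satisfied by the derivatives of the quantum volume element. -/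
theorem eq_of_euler_recursion {V : Type*} [AddCommGroup V] [Module ℂ V]
    {m : V →ₗ[ℂ] V →ₗ[ℂ] V} (hcomm : ∀ x y, m x y = m y x)
    (hassoc : ∀ x y z, m (m x y) z = m x (m y z)) (g : V →ₗ[ℂ] V) {e Δ : V} {b1 : ℂ}
    {P D : ℕ → V} (hP0 : ∀ x, m (P 0) x = x) (hP : ∀ k, P (k + 1) = m e (P k))
    (hD1 : D 1 = (1 - b1) • Δ - g Δ)
    (hD : ∀ k, D (k + 1) = m e (D k) + m Δ (P k) - g (m Δ (P k)) - m Δ (g (P k)))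
    {k : ℕ} (hk : 1 ≤ k) :
    D k = ((k : ℂ) - b1) • m (P (k - 1)) Δ - g (m (P (k - 1)) Δ)
      - ∑ i ∈ Finset.Icc 1 (k - 1), m (m Δ (P (i - 1))) (g (P (k - i)))
      - ∑ i ∈ Finset.Icc 1 (k - 1), m (g (m Δ (P (i - 1)))) (P (k - i)) := by
  induction k, hk using Nat.le_induction with
  | base => simp [hP0, hD1]
  | succ k hk ih =>
    obtain ⟨n, rfl⟩ : ∃ n, k = n + 1 := ⟨k - 1, by omega⟩
    have hIcc : ∀ (f : ℕ → V) (l : ℕ), ∑ i ∈ Finset.Icc 1 l, f i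
        = ∑ i ∈ Finset.range l, f (i + 1) := by
      intro f l
      rw [Finset.range_eq_Ico, Finset.sum_Ico_add' f 0 l 1]
      rfl
    have hmove : ∀ x y, m e (m x y) = m (m e x) y := fun x y => (hassoc e x y).symm
    have hΔP : ∀ i, m Δ (P (i + 1)) = m e (m Δ (P i)) := by
      intro i
      rw [hP, hcomm Δ (m e (P i)), hassoc, hcomm (P i)]
    have hsum1 : m e (∑ i ∈ Finset.range n, m (m Δ (P i)) (g (P (n + 1 - (i + 1)))))
        + m Δ (g (P (n + 1)))
        = ∑ i ∈ Finset.range (n + 1), m (m Δ (P i)) (g (P (n + 1 + 1 - (i + 1)))) := by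
      rw [Finset.sum_range_succ', map_sum]
      congr 1
      · refine Finset.sum_congr rfl fun i _ => ?_
        rw [hΔP, hmove, show n + 1 + 1 - (i + 1 + 1) = n + 1 - (i + 1) by omega]
      · rw [hcomm Δ (P 0), hP0]
        rfl
    have hsum2 : m e (∑ i ∈ Finset.range n, m (g (m Δ (P i))) (P (n + 1 - (i + 1))))
        + m e (g (m (P n) Δ))
        = ∑ i ∈ Finset.range (n + 1), m (g (m Δ (P i))) (P (n + 1 + 1 - (i + 1))) := by
      rw [Finset.sum_range_succ, map_sum]
      congr 1
      · refine Finset.sum_congr rfl fun i hi => ?_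
        have := Finset.mem_range.1 hi
        rw [show n + 1 + 1 - (i + 1) = n + 1 - (i + 1) + 1 by omega, hP, hcomm e, hassoc,
          hcomm _ e]
      · rw [show n + 1 + 1 - (n + 1) = 0 + 1 by omega, hcomm (P n)]
        rw [hP, hcomm e (P 0), hP0, hcomm e]
    rw [hD, ih]
    simp only [hIcc, Nat.add_sub_cancel]
    rw [← hsum1, ← hsum2]
    simp only [map_sub, map_smul]
    rw [hcomm (P (n + 1)) Δ, hΔP, hcomm (P n) Δ]
    push_cast
    module


/-- Derivative of the quantum volume element along quantum powers of the Euler field: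
for `k ≥ 1`,
`∇_{E^k}Δ = Σ_{α,β} ⟨⟨E^k γ^α γ_α γ^β⟩⟩₀ γ_β
  = (k−b₁) E^{k−1}∘Δ − G(E^{k−1}∘Δ) − Σ_{i=1}^{k−1} Δ∘E^{i−1}∘G(E^{k−i})
    − Σ_{i=1}^{k−1} G(Δ∘E^{i−1})∘E^{k−i}`. -/
theorem nabla_epow_qvol
    {N : ℕ} [NeZero N]
    (ηm ηinv : Matrix (Fin N) (Fin N) ℂ)
    (hηsym : ηm.IsSymm)
    (hη1 : ηm * ηinv = 1) (hη2 : ηinv * ηm = 1)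
    (b : Fin N → ℂ)
    (hb : ∀ α β, ηinv α β ≠ 0 → b α + b β = 1)
    (c : Pt N) (C : Matrix (Fin N) (Fin N) ℂ) (hC : C.IsSymm)
    (F0 : Pt N → ℂ)
    (hF0 : ∀ t, AnalyticAt ℂ F0 t)
    (hid : ∀ v : VF N, qp F0 ηinv (bas 0) v = v)
    (hwdvv : ∀ u v w : VF N,
      qp F0 ηinv (qp F0 ηinv u v) w = qp F0 ηinv u (qp F0 ηinv v w))
    (hqh0 : ∀ t, fderiv ℂ F0 t (euler c b (b 0) t)
      = 2 * (b 0 + 1) * F0 t + (1/2) * ∑ α, ∑ β, C α β * t α * t β) :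
    ∀ (k : ℕ), 1 ≤ k → ∀ t : Pt N,
      nablaVF (epow F0 ηinv (euler c b (b 0)) k) (qvol F0 ηinv) t
        = ∑ β, (∑ α, corr F0 [epow F0 ηinv (euler c b (b 0)) k,
              dua ηinv α, bas α, dua ηinv β] t) • (Pi.single β 1 : Pt N)
      ∧
      (∑ β, (∑ α, corr F0 [epow F0 ηinv (euler c b (b 0)) k,
              dua ηinv α, bas α, dua ηinv β] t) • (Pi.single β 1 : Pt N))
        = ((k : ℂ) - b 0) •
              qp F0 ηinv (epow F0 ηinv (euler c b (b 0)) (k - 1)) (qvol F0 ηinv) t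
          - Gop b (qp F0 ηinv (epow F0 ηinv (euler c b (b 0)) (k - 1)) (qvol F0 ηinv)) t
          - ∑ i ∈ Finset.Icc 1 (k - 1),
              qp F0 ηinv
                (qp F0 ηinv (qvol F0 ηinv) (epow F0 ηinv (euler c b (b 0)) (i - 1)))
                (Gop b (epow F0 ηinv (euler c b (b 0)) (k - i))) t
          - ∑ i ∈ Finset.Icc 1 (k - 1),
              qp F0 ηinv
                (Gop b (qp F0 ηinv (qvol F0 ηinv) (epow F0 ηinv (euler c b (b 0)) (i - 1))))
                (epow F0 ηinv (euler c b (b 0)) (k - i)) t := by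
  have hη : ηinv.IsSymm := by
    have h := congrArg Matrix.transpose hη1
    rw [Matrix.transpose_mul, hηsym.eq, Matrix.transpose_one] at h
    calc ηinv.transpose = ηinv.transpose * (ηm * ηinv) := by rw [hη1, mul_one]
      _ = ηinv := by rw [← mul_assoc, h, one_mul]
  intro k hk t
  rw [nablaVF_qvol hF0, sum_corr_smul_single]
  refine ⟨rfl, ?_⟩
  have hP0 := qmul_epow_zero hid (euler c b (b 0)) t
  have hP1 : epow F0 ηinv (euler c b (b 0)) 1 t = euler c b (b 0) t := by
    rw [epow_succ, qmul_comm hF0, hP0]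
  have hrec := eq_of_euler_recursion (qmul_comm hF0 t) (qmul_assoc hwdvv t) (gradingMap b)
    (P := fun j => epow F0 ηinv (euler c b (b 0)) j t)
    (D := fun j => ∑ α,
      quart F0 ηinv t (epow F0 ηinv (euler c b (b 0)) j t) (ηinv α) (Pi.single α 1))
    hP0 (fun j => epow_succ _ j t)
    (by
      simp only [hP1]
      exact sum_quart_euler hη hb hC hF0 hqh0 t)
    (fun j => by
      simp only [epow_succ]
      exact sum_quart_euler_qmul hη hb hC hF0 hwdvv hqh0 t _) hk
  simp only [qp_eq_qmul, Gop_eq_gradingMap]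
  exact hrec
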